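/- arXiv:2102.01550 — 5 statements merged into one kernel-verified Lean document; each statement's English description precedes it below -/
import Mathlib

section
/- Let g : (0,∞) → [0,∞) be a non-decreasing function. Then for all real numbers a > 0, b > 0 and ε > 0 one has the Young-type inequality g(a)·b ≤ ε·g(a)·a + g(b/ε)·b. -/
/-- Inequality (2.6): a Young-type inequality for a non-decreasing function `g`. -/
theorem young_type_inequality
    (g : ℝ → ℝ) (hmono : MonotoneOn g (Set.Ioi 0))
    (hnonneg : ∀ v ∈ Set.Ioi (0 : ℝ), 0 ≤ g v) :
    ∀ a b ε : ℝ, 0 < a → 0 < b → 0 < ε →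
      g a * b ≤ ε * g a * a + g (b / ε) * b := by
  intro a b ε ha hb hε
  have hbε : 0 < b / ε := div_pos hb hε
  have hga : 0 ≤ g a := hnonneg a ha
  have hgb : 0 ≤ g (b / ε) := hnonneg _ hbε
  rcases le_total a (b / ε) with h | h
  · have hg : g a * b ≤ g (b / ε) * b :=
      mul_le_mul_of_nonneg_right (hmono ha hbε h) hb.le
    have : 0 ≤ ε * g a * a := by positivity
    linarith
  · have hg : g a * b ≤ g a * (a * ε) :=
      mul_le_mul_of_nonneg_left ((div_le_iff₀ hε).mp h) hga
    have : 0 ≤ g (b / ε) * b := by positivity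
    linarith
end

section
/- Let p > 1 and let B, K, r, μ > 0 be real numbers. Let b₁, b₂ ≥ 0 satisfy |b₁ − b₂| ≤ B·r·μ. Define g_b(t) := t^{p−1}·(1 + ln(1 + b·t)) for t > 0. Then for every v with 0 < v ≤ K/μ one has g_{b₁}(v/r) − g_{b₂}(v/r) ≤ ln(1 + B·K)·g_{b₂}(v/r), and consequently g_{b₁}(v/r) ≤ (1 + ln(1 + B·K))·g_{b₂}(v/r). -/
/-- An increment `a ≤ c + d` of the argument raises `log (1 + ·)` by at most `log (1 + d)`. -/
theorem log_one_add_le_add_log_one_add {a c d : ℝ} (ha : 0 ≤ a) (hc : 0 ≤ c) (hd : 0 ≤ d)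
    (h : a ≤ c + d) : Real.log (1 + a) ≤ Real.log (1 + c) + Real.log (1 + d) := by
  rw [← Real.log_mul (by positivity) (by positivity)]
  exact Real.log_le_log (by positivity) (by nlinarith [mul_nonneg hc hd])

/-- Remark 1.2: the function `g_b(t) = t^(p-1)·(1 + ln(1 + b·t))` with oscillation bound
`|b₁ - b₂| ≤ B·r·μ` satisfies the non-logarithmic condition (g₂). -/
theorem borderline_log_g2_condition
    (p B K r μ : ℝ) (hp : 1 < p)
    (hB : 0 < B) (hK : 0 < K) (hr : 0 < r) (hμ : 0 < μ)
    (b₁ b₂ : ℝ) (hb₁ : 0 ≤ b₁) (hb₂ : 0 ≤ b₂)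
    (hosc : |b₁ - b₂| ≤ B * r * μ) :
    ∀ v : ℝ, 0 < v → v ≤ K / μ →
      (v / r) ^ (p - 1) * (1 + Real.log (1 + b₁ * (v / r))) -
          (v / r) ^ (p - 1) * (1 + Real.log (1 + b₂ * (v / r))) ≤
        Real.log (1 + B * K) * ((v / r) ^ (p - 1) * (1 + Real.log (1 + b₂ * (v / r)))) ∧
      (v / r) ^ (p - 1) * (1 + Real.log (1 + b₁ * (v / r))) ≤
        (1 + Real.log (1 + B * K)) * ((v / r) ^ (p - 1) * (1 + Real.log (1 + b₂ * (v / r)))) := by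
  intro v hv hvK
  have hinc : b₁ * (v / r) ≤ b₂ * (v / r) + B * K := by
    have hvμ : v * μ ≤ K := (le_div_iff₀ hμ).mp hvK
    calc b₁ * (v / r) = b₂ * (v / r) + (b₁ - b₂) * (v / r) := by ring
      _ ≤ b₂ * (v / r) + B * r * μ * (v / r) := by
        gcongr
        exact (le_abs_self _).trans hosc
      _ = b₂ * (v / r) + B * (v * μ) := by
        field_simp
      _ ≤ b₂ * (v / r) + B * K := by gcongr
  have hlog := log_one_add_le_add_log_one_add (by positivity) (by positivity) (by positivity) hinc
  have hBK : 0 ≤ Real.log (1 + B * K) := Real.log_nonneg (by nlinarith [mul_pos hB hK])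
  have hlog₂ : 0 ≤ Real.log (1 + b₂ * (v / r)) :=
    Real.log_nonneg (le_add_of_nonneg_right (by positivity))
  have hfactor : 1 + Real.log (1 + b₁ * (v / r)) ≤
      (1 + Real.log (1 + B * K)) * (1 + Real.log (1 + b₂ * (v / r))) := by
    nlinarith [mul_nonneg hBK hlog₂]
  have hpow : 0 ≤ (v / r) ^ (p - 1) := by positivity
  have hmain := mul_le_mul_of_nonneg_left hfactor hpow
  constructor <;> linarith
end

section
/- Let 1 < p < 2, β > 0 and a > 0. Then the function ψ(v) := v^{p−2} + a·(1 + ln(1+v))^{β} is monotone non-decreasing on the interval [(8/(β·a))^{2/(2−p)} + 1, ∞). -/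
theorem mul_one_add_log_one_add_le_rpow {s v : ℝ} (hs0 : 0 < s) (hs1 : s ≤ 1) (hv : 1 ≤ v) :
    s * (1 + Real.log (1 + v)) ≤ 2 * v ^ (s / 2) := by
  have hv0 : 0 < v := by linarith
  have hlog : Real.log (1 + v) ≤ 1 + Real.log v := by
    have h : Real.log (1 + v) ≤ Real.log (2 * v) := Real.log_le_log (by linarith) (by linarith)
    rw [Real.log_mul two_ne_zero hv0.ne'] at h
    linarith [Real.log_le_sub_one_of_pos (zero_lt_two (α := ℝ))]
  have hpow := Real.log_le_sub_one_of_pos (Real.rpow_pos_of_pos hv0 (s / 2))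
  rw [Real.log_rpow hv0] at hpow
  nlinarith

theorem hasDerivAt_rpow_add_mul_one_add_log_rpow (q a β : ℝ) {v : ℝ} (hv : 0 < v) :
    HasDerivAt (fun v : ℝ => v ^ q + a * (1 + Real.log (1 + v)) ^ β)
      (q * v ^ (q - 1) + a * (1 / (1 + v) * β * (1 + Real.log (1 + v)) ^ (β - 1))) v := by
  have hL : 0 < Real.log (1 + v) := Real.log_pos (by linarith)
  have h1 : HasDerivAt (fun v : ℝ => 1 + Real.log (1 + v)) (1 / (1 + v)) v :=
    (((hasDerivAt_id v).const_add 1).log (by simp only [id]; positivity)).const_add 1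
  exact (Real.hasDerivAt_rpow_const (Or.inl hv.ne')).add
    ((h1.rpow_const (Or.inl (by positivity))).const_mul a)

/-- Remark 1.5 (borderline case `q̃ = 2`): the function `ψ(v) = v^(p-2) + a·(1+ln(1+v))^β`
is non-decreasing on `[(8/(β·a))^(2/(2-p)) + 1, ∞)`. -/
theorem psi_log_borderline_monotone
    (p β a : ℝ) (hp : 1 < p) (hp2 : p < 2) (hβ : 0 < β) (ha : 0 < a) :
    MonotoneOn (fun v : ℝ => v ^ (p - 2) + a * (1 + Real.log (1 + v)) ^ β)
      (Set.Ici ((8 / (β * a)) ^ (2 / (2 - p)) + 1)) := by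
  have hc : 0 < 8 / (β * a) := by positivity
  have hs : 0 < 2 - p := by linarith
  have hM : 0 < (8 / (β * a)) ^ (2 / (2 - p)) := Real.rpow_pos_of_pos hc _
  have hd : ∀ v ∈ Set.Ici ((8 / (β * a)) ^ (2 / (2 - p)) + 1), _ := fun v hv =>
    hasDerivAt_rpow_add_mul_one_add_log_rpow (p - 2) a β
      (show 0 < v by linarith [Set.mem_Ici.mp hv])
  refine monotoneOn_of_hasDerivWithinAt_nonneg (convex_Ici _)
    (fun v hv => (hd v hv).continuousAt.continuousWithinAt)
    (fun v hv => (hd v (interior_subset hv)).hasDerivWithinAt) fun v hv => ?_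
  have hv' := Set.mem_Ici.mp (interior_subset hv)
  have hv1 : 1 ≤ v := by linarith
  have hv0 : 0 < v := by linarith
  have hlog := mul_one_add_log_one_add_le_rpow hs (by linarith) hv1
  have hL : 0 ≤ Real.log (1 + v) := Real.log_nonneg (by linarith)
  have hX : (1 + Real.log (1 + v))⁻¹ ≤ (1 + Real.log (1 + v)) ^ (β - 1) := by
    rw [← Real.rpow_neg_one]
    exact Real.rpow_le_rpow_of_exponent_le (by linarith) (by linarith)
  have hw : 8 / (β * a) ≤ v ^ ((2 - p) / 2) := by
    have h := Real.rpow_le_rpow hM.le (show _ ≤ v by linarith)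
      (show 0 ≤ (2 - p) / 2 by positivity)
    rwa [← Real.rpow_mul hc.le, div_mul_div_cancel₀ hs.ne', div_self two_ne_zero,
      Real.rpow_one] at h
  have hpow : v ^ (p - 2 - 1) = (v * (v ^ ((2 - p) / 2)) ^ 2)⁻¹ := by
    rw [← Real.rpow_natCast, ← Real.rpow_mul hv0.le, ← Real.rpow_one_add' hv0.le (by
      push_cast; linarith), ← Real.rpow_neg hv0.le]
    congr 1
    push_cast
    ring
  have hw0 : 0 < v ^ ((2 - p) / 2) := Real.rpow_pos_of_pos hv0 _
  rw [hpow]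
  generalize v ^ ((2 - p) / 2) = w at *
  generalize (1 + Real.log (1 + v)) ^ (β - 1) = X at *
  obtain ⟨Y, hY⟩ : ∃ Y, Y = 1 + Real.log (1 + v) := ⟨_, rfl⟩
  rw [← hY] at hlog hX
  have hY0 : 0 < Y := by linarith
  have hw8 : 8 ≤ w * (β * a) := (div_le_iff₀ (by positivity)).mp hw
  have key : (2 - p) * (v * w ^ 2)⁻¹ ≤ a * (1 / (1 + v) * β * Y⁻¹) := by
    have e : a * (1 / (1 + v) * β * Y⁻¹) = (β * a) / ((1 + v) * Y) := by field_simp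
    rw [e, ← div_eq_mul_inv, div_le_div_iff₀ (by positivity) (by positivity)]
    calc (2 - p) * ((1 + v) * Y) = (1 + v) * ((2 - p) * Y) := by ring
      _ ≤ (2 * v) * (2 * w) := by gcongr; linarith
      _ ≤ (v * w) * 8 := by nlinarith [mul_pos hv0 hw0]
      _ ≤ (v * w) * (w * (β * a)) := by gcongr
      _ = β * a * (v * w ^ 2) := by ring
  have : a * (1 / (1 + v) * β * Y⁻¹) ≤ a * (1 / (1 + v) * β * X) := by gcongr
  linarith
end

section
/- Let 1 < p < q and let g : (0,∞) → (0,∞) be increasing, satisfy condition (g₁) with exponents p, q, and be such that v ↦ g(v)/v is non-increasing on (0,∞). Define 𝒢(w) := ∫₀^w g(s) ds and f(w) := w/𝒢(w) for w > 0. Then for every c > 0 and every ε ∈ (0, 1/2) one has ∫₀^ε f(c·(ε + s)) ds ≤ (2q·ln 2)/(2q·ln 2 + ln(1/(2ε))) · ∫₀^1 f(c·(ε + s)) ds. -/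
open MeasureTheory Set

/-- A function that is positive and increasing on `(0, ∞)`, extended by zero, is integrable on
bounded intervals. -/
lemma intervalIntegrable_of_strictMonoOn_pos {g : ℝ → ℝ} (hgpos : ∀ v : ℝ, 0 < v → 0 < g v)
    (hgmono : StrictMonoOn g (Ioi 0)) (a b : ℝ) :
    IntervalIntegrable ((Ioi (0 : ℝ)).indicator g) volume a b := by
  refine Monotone.intervalIntegrable fun x y hxy => ?_
  by_cases hx : 0 < x
  · have hy : 0 < y := hx.trans_le hxy
    simpa [hx, hy] using hgmono.monotoneOn hx hy hxy
  · by_cases hy : 0 < y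
    · simpa [hx, hy] using (hgpos y hy).le
    · simp [hx, hy]

lemma integral_indicator_Ioi_zero (g : ℝ → ℝ) {w : ℝ} (hw : 0 ≤ w) :
    ∫ t in (0 : ℝ)..w, (Ioi (0 : ℝ)).indicator g t = ∫ t in (0 : ℝ)..w, g t := by
  refine intervalIntegral.integral_congr_ae (Filter.Eventually.of_forall fun t ht => ?_)
  rw [uIoc_of_le hw] at ht
  exact indicator_of_mem (show t ∈ Ioi (0 : ℝ) from ht.1) g

/-- Two-sided comparison of the primitive of `g` at `w` with `w * g w`. -/
lemma primitive_bounds {g : ℝ → ℝ} (hgpos : ∀ v : ℝ, 0 < v → 0 < g v)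
    (hgmono : StrictMonoOn g (Ioi 0)) (hpsi : AntitoneOn (fun v => g v / v) (Ioi 0))
    {w : ℝ} (hw : 0 < w) :
    w * g w / 2 ≤ ∫ t in (0 : ℝ)..w, g t ∧ ∫ t in (0 : ℝ)..w, g t ≤ w * g w := by
  rw [← integral_indicator_Ioi_zero g hw.le]
  have hint := intervalIntegrable_of_strictMonoOn_pos hgpos hgmono 0 w
  constructor
  · have h : ∫ t in (0 : ℝ)..w, g w / w * t = w * g w / 2 := by
      rw [intervalIntegral.integral_const_mul, integral_id]
      field_simp
      ring
    rw [← h]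
    refine intervalIntegral.integral_mono_on_of_le_Ioo hw.le
      (Continuous.intervalIntegrable (by fun_prop) _ _) hint fun t ht => ?_
    rw [indicator_of_mem (show t ∈ Ioi (0 : ℝ) from ht.1), ← le_div_iff₀ ht.1]
    exact hpsi ht.1 hw ht.2.le
  · have h : ∫ _ in (0 : ℝ)..w, g w = w * g w := by simp
    rw [← h]
    refine intervalIntegral.integral_mono_on_of_le_Ioo hw.le hint
      intervalIntegrable_const fun t ht => ?_
    rw [indicator_of_mem (show t ∈ Ioi (0 : ℝ) from ht.1)]
    exact hgmono.monotoneOn ht.1 hw ht.2.le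

lemma continuousOn_div_primitive {g : ℝ → ℝ} (hgpos : ∀ v : ℝ, 0 < v → 0 < g v)
    (hgmono : StrictMonoOn g (Ioi 0)) (hpsi : AntitoneOn (fun v => g v / v) (Ioi 0)) :
    ContinuousOn (fun w => w / ∫ t in (0 : ℝ)..w, g t) (Ioi 0) := by
  refine continuousOn_id.div ?_ fun w hw => ?_
  · refine (intervalIntegral.continuous_primitive
      (intervalIntegrable_of_strictMonoOn_pos hgpos hgmono) 0).continuousOn.congr fun w hw => ?_
    exact (integral_indicator_Ioi_zero g (le_of_lt hw)).symm
  · have := (primitive_bounds hgpos hgmono hpsi hw).1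
    have := mul_pos hw (hgpos w hw)
    linarith

lemma integral_inv_add_left {ε a b : ℝ} (ha : 0 < ε + a) (hb : 0 < ε + b) :
    ∫ s in a..b, (ε + s)⁻¹ = Real.log ((ε + b) / (ε + a)) := by
  rw [intervalIntegral.integral_comp_add_left (fun s => s⁻¹), integral_inv_of_pos ha hb]

/-- Inequality (5.8): with `f(w) = w / ∫₀^w g(s) ds`, for every `ε ∈ (0, 1/2)` one has
`∫₀^ε f(c(ε+s)) ds ≤ (2q ln 2)/(2q ln 2 + ln(1/(2ε))) ∫₀^1 f(c(ε+s)) ds`. -/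
theorem f_integral_small_part_bound
    (p q : ℝ) (hp : 1 < p) (hpq : p < q)
    (g : ℝ → ℝ) (hgpos : ∀ v : ℝ, 0 < v → 0 < g v)
    (hgmono : StrictMonoOn g (Set.Ioi 0))
    (hg1 : ∀ v w : ℝ, 0 < v → v ≤ w →
      (w / v) ^ (p - 1) ≤ g w / g v ∧ g w / g v ≤ (w / v) ^ (q - 1))
    (hpsi : AntitoneOn (fun v => g v / v) (Set.Ioi 0)) :
    ∀ c ε : ℝ, 0 < c → ε ∈ Set.Ioo (0 : ℝ) (1 / 2) →
      ∫ s in (0 : ℝ)..ε, (c * (ε + s)) / ∫ t in (0 : ℝ)..(c * (ε + s)), g t ≤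
        (2 * q * Real.log 2) / (2 * q * Real.log 2 + Real.log (1 / (2 * ε))) *
          ∫ s in (0 : ℝ)..1, (c * (ε + s)) / ∫ t in (0 : ℝ)..(c * (ε + s)), g t := by
  rintro c ε hc ⟨hε, hε2⟩
  set F : ℝ → ℝ := fun s => (c * (ε + s)) / ∫ t in (0 : ℝ)..(c * (ε + s)), g t
  set M : ℝ := 2 * ε / g (c * (2 * ε)) with hM
  have hw0 : 0 < c * (2 * ε) := by positivity
  have hg0 := hgpos _ hw0
  have hM0 : 0 < M := by positivity
  have hFcont : ContinuousOn F (Ici 0) := by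
    refine (continuousOn_div_primitive hgpos hgmono hpsi).comp
      (f := fun s => c * (ε + s)) (by fun_prop) fun s hs => ?_
    have : 0 < ε + s := add_pos_of_pos_of_nonneg hε hs
    exact mul_pos hc this
  have hinvcont : ContinuousOn (fun s : ℝ => (ε + s)⁻¹) (Ici 0) :=
    ContinuousOn.inv₀ (by fun_prop) fun s hs => (add_pos_of_pos_of_nonneg hε hs).ne'
  have hint {φ : ℝ → ℝ} (hφ : ContinuousOn φ (Ici 0)) {a b : ℝ} (ha : 0 ≤ a) (hab : a ≤ b) :
      IntervalIntegrable φ volume a b :=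
    (hφ.mono fun s hs => ha.trans hs.1).intervalIntegrable_of_Icc hab
  have hupper : ∀ s ∈ Icc (0 : ℝ) ε, F s ≤ 2 * M * (ε + s)⁻¹ := by
    intro s hs
    have hu : 0 < ε + s := by linarith [hs.1]
    have hw : 0 < c * (ε + s) := mul_pos hc hu
    have hgw := hgpos _ hw
    have hle := hpsi hw hw0 (mul_le_mul_of_nonneg_left (by linarith [hs.2]) hc.le)
    have hG := (primitive_bounds hgpos hgmono hpsi hw).1
    calc F s ≤ c * (ε + s) / (c * (ε + s) * g (c * (ε + s)) / 2) := by
          exact div_le_div_of_nonneg_left hw.le (by positivity) hG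
      _ = 2 / g (c * (ε + s)) := by field_simp
      _ ≤ 2 * M * (ε + s)⁻¹ := by
          rw [hM]
          dsimp only at hle
          rw [div_le_div_iff₀ hw0 hw] at hle
          generalize g (c * (2 * ε)) = y at hg0 hle ⊢
          generalize g (c * (ε + s)) = z at hgw hle ⊢
          field_simp
          refine le_of_mul_le_mul_left ?_ hc
          linarith
  have hlower : ∀ s ∈ Icc ε 1, M * (ε + s)⁻¹ ≤ F s := by
    intro s hs
    have hu : 0 < ε + s := by linarith [hs.1]
    have hw : 0 < c * (ε + s) := mul_pos hc hu
    have hgw := hgpos _ hw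
    have hle := hpsi hw0 hw (mul_le_mul_of_nonneg_left (by linarith [hs.1]) hc.le)
    have hG := primitive_bounds hgpos hgmono hpsi hw
    calc M * (ε + s)⁻¹ ≤ 1 / g (c * (ε + s)) := by
          rw [hM]
          dsimp only at hle
          rw [div_le_div_iff₀ hw hw0] at hle
          generalize g (c * (2 * ε)) = y at hg0 hle ⊢
          generalize g (c * (ε + s)) = z at hgw hle ⊢
          field_simp
          refine le_of_mul_le_mul_left ?_ hc
          linarith
      _ = c * (ε + s) / (c * (ε + s) * g (c * (ε + s))) := by field_simp
      _ ≤ F s := by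
          refine div_le_div_of_nonneg_left hw.le ?_ hG.2
          exact lt_of_lt_of_le (by positivity) hG.1
  have hA : ∫ s in (0 : ℝ)..ε, F s ≤ 2 * M * Real.log 2 := by
    have h := intervalIntegral.integral_mono_on hε.le (hint hFcont le_rfl hε.le)
      ((hint hinvcont le_rfl hε.le).const_mul (2 * M)) hupper
    rwa [intervalIntegral.integral_const_mul, integral_inv_add_left (by linarith) (by linarith),
      show (ε + ε) / (ε + 0) = 2 by field_simp; ring] at h
  have hB : M * Real.log (1 / (2 * ε)) ≤ ∫ s in ε..1, F s := by
    have hε1 : ε ≤ 1 := by linarith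
    have h := intervalIntegral.integral_mono_on hε1
      ((hint hinvcont hε.le hε1).const_mul M) (hint hFcont hε.le hε1) hlower
    rw [intervalIntegral.integral_const_mul,
      integral_inv_add_left (by linarith) (by linarith)] at h
    refine le_trans (mul_le_mul_of_nonneg_left ?_ hM0.le) h
    refine Real.log_le_log (by positivity) ?_
    rw [← two_mul]
    gcongr
    linarith
  have hsplit := intervalIntegral.integral_add_adjacent_intervals (hint hFcont le_rfl hε.le)
    (hint hFcont hε.le (show ε ≤ 1 by linarith))
  have hlog2 : 0 < Real.log 2 := Real.log_pos one_lt_two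
  have hL : 0 < Real.log (1 / (2 * ε)) :=
    Real.log_pos ((one_lt_div (by positivity)).2 (by linarith))
  have hq : 1 < q := hp.trans hpq
  have hK : 2 * Real.log 2 ≤ 2 * q * Real.log 2 := by nlinarith
  have hK0 : 0 < 2 * q * Real.log 2 := by positivity
  rw [← hsplit, div_mul_eq_mul_div, le_div_iff₀ (by positivity)]
  set L := Real.log (1 / (2 * ε))
  set K := 2 * q * Real.log 2
  have h1 := mul_le_mul_of_nonneg_right hA hL.le
  have h2 := mul_le_mul_of_nonneg_left hB hK0.le
  have h3 := mul_le_mul_of_nonneg_right hK (mul_pos hM0 hL).le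
  linarith
end

section
/- Let 1 < p < q, let w₀ > 0, and let g : (0,∞) → (0,∞) be increasing, satisfy condition (g₁) with exponents p, q, and be such that v ↦ g(v)/v is non-increasing on [w₀, ∞). Define 𝒢(w) := ∫₀^w g(s) ds and f(w) := w/𝒢(w) for w > 0. Then for every γ ≥ 1 and every w ≥ w₀ one has f(γ·w) ≥ (1/(γ·q))·f(w). -/
/-- A positive function that is monotone on `(0, ∞)` is integrable on every `[0, b]`. -/
theorem intervalIntegrable_of_monotoneOn_Ioi {g : ℝ → ℝ} (hgpos : ∀ v : ℝ, 0 < v → 0 < g v)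
    (hgmono : MonotoneOn g (Set.Ioi 0)) {b : ℝ} (hb : 0 ≤ b) :
    IntervalIntegrable g MeasureTheory.volume 0 b := by
  have hmono : MonotoneOn (fun x => if x ≤ 0 then 0 else g x) (Set.uIcc 0 b) := by
    intro x _ y _ hxy
    by_cases hx : x ≤ 0 <;> by_cases hy : y ≤ 0
    · simp [hx, hy]
    · simpa [hx, hy] using (hgpos y (not_le.mp hy)).le
    · exact absurd (hxy.trans hy) hx
    · simpa [hx, hy] using hgmono (not_le.mp hx) (not_le.mp hy) hxy
  refine hmono.intervalIntegrable.congr ?_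
  intro x hx
  rw [Set.uIoc_of_le hb] at hx
  simp [not_le.mpr hx.1]

/-- The growth bound `g w / g v ≤ (w / v) ^ (q - 1)` gives `w * g w ≤ q * ∫₀^w g`. -/
theorem mul_le_mul_integral_of_growth {q : ℝ} (hq : 1 < q) {g : ℝ → ℝ}
    (hgpos : ∀ v : ℝ, 0 < v → 0 < g v) {w : ℝ} (hw : 0 < w)
    (hint : IntervalIntegrable g MeasureTheory.volume 0 w)
    (hg : ∀ v : ℝ, 0 < v → v ≤ w → g w / g v ≤ (w / v) ^ (q - 1)) :
    w * g w ≤ q * ∫ t in (0 : ℝ)..w, g t := by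
  have hwq : 0 < w ^ (q - 1) := Real.rpow_pos_of_pos hw _
  have hle : (∫ t in (0 : ℝ)..w, g w / w ^ (q - 1) * t ^ (q - 1)) ≤ ∫ t in (0 : ℝ)..w, g t := by
    refine intervalIntegral.integral_mono_on_of_le_Ioo hw.le
      ((intervalIntegral.intervalIntegrable_rpow' (by linarith)).const_mul _) hint ?_
    intro t ht
    have h := hg t ht.1 ht.2.le
    have htq : 0 < t ^ (q - 1) := Real.rpow_pos_of_pos ht.1 _
    rw [Real.div_rpow hw.le ht.1.le, div_le_div_iff₀ (hgpos t ht.1) htq] at h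
    rw [div_mul_eq_mul_div, div_le_iff₀ hwq]
    linarith
  rw [intervalIntegral.integral_const_mul, integral_rpow (Or.inl (by linarith)),
    sub_add_cancel, Real.zero_rpow (by linarith), sub_zero] at hle
  have hpow : w ^ q = w ^ (q - 1) * w := by
    rw [← Real.rpow_add_one hw.ne', sub_add_cancel]
  have heq : g w / w ^ (q - 1) * (w ^ q / q) = w * g w / q := by
    rw [hpow]
    field_simp
  rw [heq, div_le_iff₀ (by linarith)] at hle
  linarith

/-- If `g v / v` is at most `g w / w` on `[w, b]`, then `∫_w^b g` is at most the integral of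
the linear function `t ↦ (g w / w) * t`. -/
theorem integral_le_of_div_le {g : ℝ → ℝ} {w b : ℝ} (hw : 0 < w) (hwb : w ≤ b)
    (hint : IntervalIntegrable g MeasureTheory.volume w b)
    (hg : ∀ t ∈ Set.Icc w b, g t / t ≤ g w / w) :
    (∫ t in w..b, g t) ≤ g w / w * ((b ^ 2 - w ^ 2) / 2) := by
  rw [← integral_id, ← intervalIntegral.integral_const_mul]
  refine intervalIntegral.integral_mono_on hwb hint
    ((continuous_const.mul continuous_id).intervalIntegrable _ _) ?_
  intro t ht
  exact (div_le_iff₀ (hw.trans_le ht.1)).mp (hg t ht)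

/-- Inequality (5.9): with `f(w) = w / ∫₀^w g(s) ds`, for `γ ≥ 1` and `w ≥ w₀` one has
`f(γ·w) ≥ f(w)/(γ·q)`. -/
theorem f_scaling_lower_bound
    (p q w₀ : ℝ) (hp : 1 < p) (hpq : p < q) (hw₀ : 0 < w₀)
    (g : ℝ → ℝ) (hgpos : ∀ v : ℝ, 0 < v → 0 < g v)
    (hgmono : StrictMonoOn g (Set.Ioi 0))
    (hg1 : ∀ v w : ℝ, 0 < v → v ≤ w →
      (w / v) ^ (p - 1) ≤ g w / g v ∧ g w / g v ≤ (w / v) ^ (q - 1))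
    (hpsi : AntitoneOn (fun v => g v / v) (Set.Ici w₀)) :
    ∀ γ w : ℝ, 1 ≤ γ → w₀ ≤ w →
      (1 / (γ * q)) * (w / ∫ t in (0 : ℝ)..w, g t) ≤
        (γ * w) / ∫ t in (0 : ℝ)..(γ * w), g t := by
  intro γ w hγ hw
  have hw0 : 0 < w := hw₀.trans_le hw
  have hwγ : w ≤ γ * w := le_mul_of_one_le_left hw0.le hγ
  have hγw0 : 0 < γ * w := hw0.trans_le hwγ
  have hi := intervalIntegrable_of_monotoneOn_Ioi hgpos hgmono.monotoneOn hw0.le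
  have hiγ := intervalIntegrable_of_monotoneOn_Ioi hgpos hgmono.monotoneOn hγw0.le
  have hlow := mul_le_mul_integral_of_growth (hp.trans hpq) hgpos hw0 hi
    fun v hv hvw => (hg1 v w hv hvw).2
  have hup := integral_le_of_div_le hw0 hwγ (hi.symm.trans hiγ)
    fun t ht => hpsi (Set.mem_Ici.mpr hw) (Set.mem_Ici.mpr (hw.trans ht.1)) ht.1
  have hadd := intervalIntegral.integral_add_adjacent_intervals hi (hi.symm.trans hiγ)
  have hG : 0 < ∫ t in (0 : ℝ)..w, g t :=
    intervalIntegral.intervalIntegral_pos_of_pos_on hi (fun t ht => hgpos t ht.1) hw0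
  have hGγ : 0 < ∫ t in (0 : ℝ)..(γ * w), g t :=
    intervalIntegral.intervalIntegral_pos_of_pos_on hiγ (fun t ht => hgpos t ht.1) hγw0
  have heq : g w / w * (((γ * w) ^ 2 - w ^ 2) / 2) = w * g w * ((γ ^ 2 - 1) / 2) := by
    field_simp
  rw [heq] at hup
  set G := ∫ t in (0 : ℝ)..w, g t
  set H := ∫ t in (0 : ℝ)..(γ * w), g t
  have hγ2 : 0 ≤ (γ ^ 2 - 1) / 2 := by nlinarith
  have hq : 1 < q := hp.trans hpq
  have hcoef : 1 + q * ((γ ^ 2 - 1) / 2) ≤ q * γ ^ 2 := by nlinarith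
  have hmain : H ≤ q * γ ^ 2 * G := by
    have h1 := mul_le_mul_of_nonneg_right hlow hγ2
    have h2 := mul_le_mul_of_nonneg_right hcoef hG.le
    linarith
  have hγ0 : 0 < γ := by linarith
  rw [div_mul_div_comm, one_mul, div_le_div_iff₀ (by positivity) hGγ]
  have h3 := mul_le_mul_of_nonneg_left hmain hw0.le
  linarith
end
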